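/- Let α > 0, let (σ_n)_{n≥1} be a strictly monotone sequence of distinct reals converging to σ_0 ∈ ℝ with lim_{n→∞} n^α (σ_n − σ_0) = L for some L ≠ 0, and assume the sequence of absolute gaps |σ_{n+1} − σ_n| is nonincreasing (so the gaps vanish monotonically). Let 𝓗 = ℓ²(ℕ, ℂ) and for ψ = (ψ_n) ∈ 𝓗 set μ_ψ = Σ_{n≥1} |ψ_n|² δ_{σ_n}. Then there exists a generic subset R of 𝓗 such that for every ψ ∈ R and every q ∈ (0,1), D⁻_{μ_ψ}(q) = 0 and D⁺_{μ_ψ}(q) = 1/(1+α). -/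

import Mathlib

open MeasureTheory Filter Set Topology ENNReal

noncomputable section

/-- `I_μ(q, ε) = ∫ μ(B(x,ε))^{q-1} dμ(x)`, integrated over `{x : μ(B(x,ε)) > 0}`. -/
def fracIntegral (μ : Measure ℝ) (q ε : ℝ) : ℝ≥0∞ :=
  ∫⁻ x in {x : ℝ | 0 < μ (Ioo (x - ε) (x + ε))}, μ (Ioo (x - ε) (x + ε)) ^ (q - 1) ∂μ

/-- lower q-generalized fractal dimension. -/
def Dlower (μ : Measure ℝ) (q : ℝ) : ℝ :=
  liminf (fun ε : ℝ => Real.log (fracIntegral μ q ε).toReal / ((q - 1) * Real.log ε)) (𝓝[>] 0)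

/-- upper q-generalized fractal dimension. -/
def Dupper (μ : Measure ℝ) (q : ℝ) : ℝ :=
  limsup (fun ε : ℝ => Real.log (fracIntegral μ q ε).toReal / ((q - 1) * Real.log ε)) (𝓝[>] 0)

instance : Fact ((1 : ℝ≥0∞) ≤ 2) := ⟨one_le_two⟩

theorem setLIntegral_biUnion_finset_le {α ι : Type*} [MeasurableSpace α] (μ : Measure α)
    (s : Finset ι) (I : ι → Set α) (f : α → ℝ≥0∞) :
    ∫⁻ x in ⋃ i ∈ s, I i, f x ∂μ ≤ ∑ i ∈ s, ∫⁻ x in I i, f x ∂μ := by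
  classical
  induction s using Finset.induction_on with
  | empty => simp
  | insert a s ha ih =>
    rw [Finset.set_biUnion_insert, Finset.sum_insert ha]
    exact (lintegral_union_le f _ _).trans (by gcongr)

theorem fracIntegral_le_sum_rpow {ι : Type*} (μ : Measure ℝ) [IsFiniteMeasure μ] {q ε : ℝ}
    (hq : q < 1) (s : Finset ι) (I : ι → Set ℝ) (hm : ∀ i, MeasurableSet (I i))
    (hcover : μ (⋃ i ∈ s, I i)ᶜ = 0)
    (hI : ∀ i ∈ s, ∀ x ∈ I i, I i ⊆ Ioo (x - ε) (x + ε)) :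
    fracIntegral μ q ε ≤ ∑ i ∈ s, μ (I i) ^ q := by
  calc fracIntegral μ q ε ≤ ∫⁻ x, μ (Ioo (x - ε) (x + ε)) ^ (q - 1) ∂μ :=
        setLIntegral_le_lintegral _ _
    _ = ∫⁻ x in ⋃ i ∈ s, I i, μ (Ioo (x - ε) (x + ε)) ^ (q - 1) ∂μ := by
        have : ∀ᵐ x ∂μ, x ∈ ⋃ i ∈ s, I i := mem_ae_iff.2 hcover
        rw [Measure.restrict_eq_self_of_ae_mem this]
    _ ≤ ∑ i ∈ s, ∫⁻ x in I i, μ (Ioo (x - ε) (x + ε)) ^ (q - 1) ∂μ :=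
        setLIntegral_biUnion_finset_le _ _ _ _
    _ ≤ ∑ i ∈ s, μ (I i) ^ q := by
        refine Finset.sum_le_sum fun i hi => ?_
        rcases eq_or_ne (μ (I i)) 0 with h0 | h0
        · rw [Measure.restrict_eq_zero.2 h0]
          simp
        · calc ∫⁻ x in I i, μ (Ioo (x - ε) (x + ε)) ^ (q - 1) ∂μ
              ≤ ∫⁻ _ in I i, μ (I i) ^ (q - 1) ∂μ := by
                refine setLIntegral_mono' (hm i) fun x hx => ?_
                rw [← neg_sub 1 q, ENNReal.rpow_neg, ENNReal.rpow_neg]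
                exact ENNReal.inv_le_inv.2
                  (ENNReal.rpow_le_rpow (measure_mono (hI i hi x hx)) (by linarith))
            _ = μ (I i) ^ q := by
                rw [setLIntegral_const]
                nth_rewrite 2 [← ENNReal.rpow_one (μ (I i))]
                rw [← ENNReal.rpow_add _ _ h0 (measure_ne_top _ _)]
                simp

theorem sum_rpow_le_card_rpow_mul {ι : Type*} (s : Finset ι) (f : ι → ℝ≥0∞) {q : ℝ}
    (hq0 : 0 < q) (hq : q < 1) :
    ∑ i ∈ s, f i ^ q ≤ (s.card : ℝ≥0∞) ^ (1 - q) * (∑ i ∈ s, f i) ^ q := by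
  have h := ENNReal.rpow_sum_le_const_mul_sum_rpow s (fun i => f i ^ q)
    (p := q⁻¹) ((one_le_inv₀ hq0).2 hq.le)
  have h2 := ENNReal.rpow_le_rpow h hq0.le
  rw [ENNReal.mul_rpow_of_nonneg _ _ hq0.le] at h2
  simp only [← ENNReal.rpow_mul, inv_mul_cancel₀ hq0.ne', mul_inv_cancel₀ hq0.ne',
    ENNReal.rpow_one] at h2
  rwa [sub_mul, inv_mul_cancel₀ hq0.ne', one_mul] at h2

/-- Indices below `n` are kept apart, the others are grouped by the cell of the grid of mesh `ε`
that contains `σ k`. -/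
def gridIndex (σ : ℕ → ℝ) (n : ℕ) (ε : ℝ) (k : ℕ) : ℕ ⊕ ℤ :=
  if k < n then Sum.inl k else Sum.inr ⌊σ k / ε⌋

theorem abs_sub_lt_of_gridIndex_eq {σ : ℕ → ℝ} {n : ℕ} {ε : ℝ} (hε : 0 < ε) {j k : ℕ}
    (h : gridIndex σ n ε j = gridIndex σ n ε k) : |σ j - σ k| < ε := by
  unfold gridIndex at h
  split_ifs at h with h1 h2 h2
  · simp only [Sum.inl.injEq] at h
    simpa [h] using hε
  · have := Int.abs_sub_lt_one_of_floor_eq_floor (Sum.inr.inj h)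
    rwa [← sub_div, abs_div, abs_of_pos hε, div_lt_one hε] at this

/-- A finite set of cells which contains every value of `gridIndex` as soon as
`|σ k - σ0| ≤ ρ` for `k ≥ n`. -/
def gridCells (n : ℕ) (ε σ0 ρ : ℝ) : Finset (ℕ ⊕ ℤ) :=
  (Finset.range n).disjSum (Finset.Icc ⌊(σ0 - ρ) / ε⌋ ⌊(σ0 + ρ) / ε⌋)

theorem gridIndex_mem_gridCells {σ : ℕ → ℝ} {n : ℕ} {ε σ0 ρ : ℝ} (hε : 0 < ε)
    (hρ : ∀ k ≥ n, |σ k - σ0| ≤ ρ) (k : ℕ) : gridIndex σ n ε k ∈ gridCells n ε σ0 ρ := by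
  unfold gridIndex gridCells
  split_ifs with h
  · simpa using h
  · have := abs_le.1 (hρ k (not_lt.1 h))
    rw [Finset.inr_mem_disjSum, Finset.mem_Icc]
    constructor <;> apply Int.floor_le_floor <;> gcongr <;> linarith

theorem card_Icc_floor_le {ε σ0 ρ : ℝ} (hε : 0 < ε) (hρ : 0 ≤ ρ) :
    ((Finset.Icc ⌊(σ0 - ρ) / ε⌋ ⌊(σ0 + ρ) / ε⌋).card : ℝ) ≤ 2 * ρ / ε + 2 := by
  have h1 := Int.floor_le ((σ0 + ρ) / ε)
  have h2 := Int.lt_floor_add_one ((σ0 - ρ) / ε)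
  have h3 : ⌊(σ0 - ρ) / ε⌋ ≤ ⌊(σ0 + ρ) / ε⌋ := by
    apply Int.floor_le_floor; gcongr; linarith
  have h4 : (σ0 + ρ) / ε - (σ0 - ρ) / ε = 2 * ρ / ε := by ring
  rw [Int.card_Icc, ← Int.cast_natCast (R := ℝ), Int.toNat_of_nonneg (by omega)]
  push_cast
  linarith

section Bounds

variable {μ : Measure ℝ} [IsFiniteMeasure μ] {σ : ℕ → ℝ} {q ε σ0 ρ : ℝ} {n : ℕ}

theorem fracIntegral_le_sum_gridCells (hμ : μ (range σ)ᶜ = 0) (hq : q < 1) (hε : 0 < ε)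
    (hρ : ∀ k ≥ n, |σ k - σ0| ≤ ρ) :
    fracIntegral μ q ε ≤
      ∑ i ∈ gridCells n ε σ0 ρ, μ (σ '' (gridIndex σ n ε ⁻¹' {i})) ^ q := by
  refine fracIntegral_le_sum_rpow μ hq _ _
    (fun i => ((Set.to_countable _).image σ).measurableSet) ?_ ?_
  · refine measure_mono_null (compl_subset_compl.2 ?_) hμ
    rintro _ ⟨k, rfl⟩
    exact mem_biUnion (gridIndex_mem_gridCells hε hρ k) ⟨k, rfl, rfl⟩
  · rintro i - _ ⟨j, hj, rfl⟩ _ ⟨k, hk, rfl⟩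
    have := abs_lt.1 (abs_sub_lt_of_gridIndex_eq (σ := σ) (n := n) hε
      ((mem_singleton_iff.1 hk).trans (mem_singleton_iff.1 hj).symm))
    constructor <;> linarith

theorem fracIntegral_le_rpow_mul (hμ : μ (range σ)ᶜ = 0) (hσ : Function.Injective σ)
    (hq0 : 0 < q) (hq : q < 1) (hε : 0 < ε) (hρ : ∀ k ≥ n, |σ k - σ0| ≤ ρ) :
    fracIntegral μ q ε ≤ ENNReal.ofReal (n + (2 * ρ / ε + 2)) ^ (1 - q) * μ univ ^ q := by
  refine (fracIntegral_le_sum_gridCells hμ hq hε hρ).trans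
    ((sum_rpow_le_card_rpow_mul _ _ hq0 hq).trans ?_)
  gcongr
  · rw [← ENNReal.ofReal_natCast]
    apply ENNReal.ofReal_le_ofReal
    rw [gridCells, Finset.card_disjSum, Finset.card_range]
    push_cast
    gcongr
    exact card_Icc_floor_le hε ((abs_nonneg _).trans (hρ n le_rfl))
  · refine sum_measure_le_measure_univ
      (fun i _ => ((Set.to_countable _).image σ).measurableSet.nullMeasurableSet) ?_
    intro i _ j _ hij
    refine Disjoint.aedisjoint ((disjoint_image_iff hσ).2 ?_)
    exact Disjoint.preimage _ (by simpa using hij)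

theorem fracIntegral_le_add_mul (hμ : μ (range σ)ᶜ = 0) (hq0 : 0 < q) (hq : q < 1) (hε : 0 < ε)
    (hρ : ∀ k ≥ n, |σ k - σ0| ≤ ρ) :
    fracIntegral μ q ε ≤
      n * μ univ ^ q + ENNReal.ofReal (2 * ρ / ε + 2) * μ (σ '' Ici n) ^ q := by
  refine (fracIntegral_le_sum_gridCells hμ hq hε hρ).trans ?_
  rw [gridCells, Finset.sum_disjSum]
  gcongr
  · refine (Finset.sum_le_card_nsmul _ _ (μ univ ^ q) fun k _ => ?_).trans (by simp)
    gcongr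
    exact subset_univ _
  · refine (Finset.sum_le_card_nsmul _ _ (μ (σ '' Ici n) ^ q) fun j _ => ?_).trans ?_
    · gcongr
      intro k hk
      simp only [gridIndex, mem_preimage, mem_singleton_iff] at hk
      split_ifs at hk with h
      exact not_lt.1 h
    · rw [nsmul_eq_mul, ← ENNReal.ofReal_natCast]
      gcongr
      exact card_Icc_floor_le hε ((abs_nonneg _).trans (hρ n le_rfl))

end Bounds

theorem sum_le_fracIntegral {μ : Measure ℝ} {σ : ℕ → ℝ} {q ε : ℝ}
    (hσ : Function.Injective σ) (hε : 0 < ε) (s : Finset ℕ)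
    (hs : ∀ k ∈ s, μ {σ k} ≠ 0) :
    ∑ k ∈ s, μ (Ioo (σ k - ε) (σ k + ε)) ^ (q - 1) * μ {σ k} ≤ fracIntegral μ q ε := by
  classical
  have h := lintegral_finset (μ := μ) (s.image σ) fun x => μ (Ioo (x - ε) (x + ε)) ^ (q - 1)
  rw [Finset.sum_image hσ.injOn] at h
  rw [← h, fracIntegral]
  refine lintegral_mono_set ?_
  intro x hx
  obtain ⟨k, hk, rfl⟩ := by simpa using hx
  exact (pos_iff_ne_zero.2 (hs k hk)).trans_le
    (measure_mono (by simpa using hε))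

/-- The measure `∑ |ψ_k|² δ_{σ_k}`. -/
def spectralMeasure (σ : ℕ → ℝ) (ψ : lp (fun _ : ℕ => ℂ) 2) : Measure ℝ :=
  Measure.sum fun k : ℕ => ENNReal.ofReal (‖ψ k‖ ^ 2) • Measure.dirac (σ k)

section SpectralMeasure

variable (σ : ℕ → ℝ) (ψ : lp (fun _ : ℕ => ℂ) 2)

theorem hasSum_norm_sq : HasSum (fun k => ‖ψ k‖ ^ 2) (‖ψ‖ ^ 2) := by
  simpa using lp.hasSum_norm (p := 2) (by norm_num) ψ

theorem spectralMeasure_compl_range : spectralMeasure σ ψ (range σ)ᶜ = 0 := by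
  rw [spectralMeasure, Measure.sum_apply _ (countable_range σ).measurableSet.compl]
  simp

theorem spectralMeasure_univ : spectralMeasure σ ψ univ = ENNReal.ofReal (‖ψ‖ ^ 2) := by
  rw [spectralMeasure, Measure.sum_apply _ MeasurableSet.univ, ← (hasSum_norm_sq ψ).tsum_eq,
    ENNReal.ofReal_tsum_of_nonneg (fun _ => by positivity) (hasSum_norm_sq ψ).summable]
  simp

instance : IsFiniteMeasure (spectralMeasure σ ψ) :=
  ⟨by rw [spectralMeasure_univ]; exact ENNReal.ofReal_lt_top⟩

variable {σ}

theorem spectralMeasure_singleton (hσ : Function.Injective σ) (k : ℕ) :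
    spectralMeasure σ ψ {σ k} = ENNReal.ofReal (‖ψ k‖ ^ 2) := by
  rw [spectralMeasure, Measure.sum_apply _ (measurableSet_singleton _), tsum_eq_single k]
  · simp
  · intro j hj
    simp [hσ.ne hj]

theorem spectralMeasure_image_Ici_le (hσ : Function.Injective σ) {n : ℕ} {δ : ℝ}
    (h : ‖ψ‖ ^ 2 ≤ ∑ k ∈ Finset.range n, ‖ψ k‖ ^ 2 + δ) :
    spectralMeasure σ ψ (σ '' Ici n) ≤ ENNReal.ofReal δ := by
  classical
  have h1 : spectralMeasure σ ψ ((Finset.range n).image σ) =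
      ENNReal.ofReal (∑ k ∈ Finset.range n, ‖ψ k‖ ^ 2) := by
    rw [← sum_measure_singleton, Finset.sum_image hσ.injOn,
      ENNReal.ofReal_sum_of_nonneg fun _ _ => by positivity]
    exact Finset.sum_congr rfl fun k _ => spectralMeasure_singleton ψ hσ k
  have h2 : Disjoint (((Finset.range n).image σ : Finset ℝ) : Set ℝ) (σ '' Ici n) := by
    rw [Finset.coe_image, disjoint_image_iff hσ, Set.disjoint_left]
    intro k hk hk'
    exact absurd (Finset.mem_range.1 hk) (not_lt.2 hk')
  have h3 := (measure_union h2 ((Set.to_countable _).image σ).measurableSet).symm.trans_le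
    (measure_mono (μ := spectralMeasure σ ψ) (subset_univ _))
  rw [spectralMeasure_univ, h1] at h3
  have h4 := h3.trans ((ENNReal.ofReal_le_ofReal h).trans ENNReal.ofReal_add_le)
  exact (ENNReal.add_le_add_iff_left ENNReal.ofReal_ne_top).1 h4

end SpectralMeasure

section Residual

theorem setOf_frequently_mem_residual {X : Type*} [TopologicalSpace X] {U : ℕ → Set X}
    (hU : ∀ n, IsOpen (U n))
    (hd : ∀ x, ∃ u : ℕ → X, Tendsto u atTop (𝓝 x) ∧ ∀ᶠ n in atTop, u n ∈ U n) :
    {x | ∃ᶠ n in atTop, x ∈ U n} ∈ residual X := by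
  have h : {x | ∃ᶠ n in atTop, x ∈ U n} = ⋂ m : ℕ, ⋃ n ≥ m, U n := by
    ext x; simp [frequently_atTop]
  rw [h, countable_iInter_mem]
  refine fun m => residual_of_dense_open (isOpen_biUnion fun n _ => hU n) fun x => ?_
  obtain ⟨u, hu, hmem⟩ := hd x
  refine mem_closure_of_tendsto hu ?_
  filter_upwards [hmem, eventually_ge_atTop m] with n hn hm
  exact mem_biUnion hm hn

theorem continuous_lp_apply (k : ℕ) : Continuous fun ψ : lp (fun _ : ℕ => ℂ) 2 => ψ k :=
  (lp.lipschitzWith_one_eval (E := fun _ : ℕ => ℂ) 2 k).continuous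

theorem sum_single_apply (s : Finset ℕ) (f : ℕ → ℂ) (k : ℕ) :
    (∑ i ∈ s, lp.single (E := fun _ : ℕ => ℂ) 2 i (f i)) k = if k ∈ s then f k else 0 := by
  rw [lp.coeFn_sum, Finset.sum_apply]
  simp [lp.single_apply, Pi.single_apply]

theorem norm_sq_sum_single (s : Finset ℕ) (f : ℕ → ℂ) :
    ‖∑ i ∈ s, lp.single (E := fun _ : ℕ => ℂ) 2 i (f i)‖ ^ 2 = ∑ i ∈ s, ‖f i‖ ^ 2 := by
  simpa using lp.norm_sum_single (E := fun _ : ℕ => ℂ) (p := 2) (by norm_num) f s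

theorem tendsto_sum_range_single (ψ : lp (fun _ : ℕ => ℂ) 2) :
    Tendsto (fun n => ∑ i ∈ Finset.range n, lp.single (E := fun _ : ℕ => ℂ) 2 i (ψ i)) atTop
      (𝓝 ψ) :=
  (lp.hasSum_single (by norm_num) ψ).tendsto_sum_nat

theorem frequently_small_tail_mem_residual {δ : ℕ → ℝ} (hδ : ∀ n, 0 < δ n) :
    {ψ : lp (fun _ : ℕ => ℂ) 2 |
      ∃ᶠ n in atTop, ‖ψ‖ ^ 2 < ∑ k ∈ Finset.range n, ‖ψ k‖ ^ 2 + δ n} ∈ residual _ := by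
  refine setOf_frequently_mem_residual (U := fun n => {ψ : lp (fun _ : ℕ => ℂ) 2 |
      ‖ψ‖ ^ 2 < ∑ k ∈ Finset.range n, ‖ψ k‖ ^ 2 + δ n}) (fun n => ?_) fun ψ =>
    ⟨fun n => ∑ i ∈ Finset.range n, lp.single (E := fun _ : ℕ => ℂ) 2 i (ψ i),
      tendsto_sum_range_single ψ, Eventually.of_forall fun n => ?_⟩
  · refine isOpen_lt (continuous_norm.pow 2) (Continuous.add ?_ continuous_const)
    exact continuous_finsetSum _ fun k _ => (continuous_lp_apply k).norm.pow 2
  · have h : ∑ k ∈ Finset.range n,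
        ‖(∑ i ∈ Finset.range n, lp.single (E := fun _ : ℕ => ℂ) 2 i (ψ i)) k‖ ^ 2 =
        ∑ k ∈ Finset.range n, ‖ψ k‖ ^ 2 := by
      refine Finset.sum_congr rfl fun k hk => ?_
      rw [sum_single_apply _ fun i => ψ i, if_pos hk]
    refine (norm_sq_sum_single (Finset.range n) fun i => ψ i).trans_lt ?_
    exact (lt_add_of_pos_right _ (hδ n)).trans_eq (congrArg (· + δ n) h.symm)

theorem frequently_large_block_mem_residual {c : ℕ → ℝ} (hc0 : ∀ n, 0 ≤ c n)
    (hc : Tendsto (fun n : ℕ => n * c n) atTop (𝓝 0)) (hpos : ∀ᶠ n in atTop, 0 < c n) :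
    {ψ : lp (fun _ : ℕ => ℂ) 2 |
      ∃ᶠ n in atTop, ∀ k ∈ Finset.Ico n (2 * n), c n < ‖ψ k‖ ^ 2} ∈ residual _ := by
  refine setOf_frequently_mem_residual
    (U := fun n => {ψ | ∀ k ∈ Finset.Ico n (2 * n), c n < ‖ψ k‖ ^ 2}) (fun n => ?_) fun ψ =>
    ⟨fun n => ∑ i ∈ Finset.range n, lp.single (E := fun _ : ℕ => ℂ) 2 i (ψ i) +
      ∑ i ∈ Finset.Ico n (2 * n), lp.single (E := fun _ : ℕ => ℂ) 2 i
        ((√(2 * c n) : ℝ) : ℂ), ?_, ?_⟩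
  · simp only [ofPred_forall]
    exact isOpen_biInter_finset fun k _ =>
      isOpen_lt continuous_const ((continuous_lp_apply k).norm.pow 2)
  · have h : Tendsto (fun n => ∑ i ∈ Finset.Ico n (2 * n),
        lp.single (E := fun _ : ℕ => ℂ) 2 i ((√(2 * c n) : ℝ) : ℂ)) atTop (𝓝 0) := by
      rw [tendsto_zero_iff_norm_tendsto_zero]
      have h2 : ∀ n, ‖∑ i ∈ Finset.Ico n (2 * n),
          lp.single (E := fun _ : ℕ => ℂ) 2 i ((√(2 * c n) : ℝ) : ℂ)‖ = √(2 * (n * c n)) := by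
        intro n
        rw [← Real.sqrt_sq (norm_nonneg (∑ i ∈ Finset.Ico n (2 * n),
          lp.single (E := fun _ : ℕ => ℂ) 2 i ((√(2 * c n) : ℝ) : ℂ)))]
        rw [norm_sq_sum_single _ fun _ => ((√(2 * c n) : ℝ) : ℂ)]
        have : 2 * n - n = n := by omega
        simp only [Finset.sum_const, Nat.card_Ico, this, Complex.norm_real, Real.norm_eq_abs,
          sq_abs, Real.sq_sqrt (mul_nonneg zero_le_two (hc0 n)), nsmul_eq_mul]
        congr 1
        ring
      simp only [h2]
      simpa using (hc.const_mul 2).sqrt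
    simpa using (tendsto_sum_range_single ψ).add h
  · filter_upwards [hpos] with n hn k hk
    have hk' : k ∉ Finset.range n := by simpa using (Finset.mem_Ico.1 hk).1
    rw [lp.coeFn_add, Pi.add_apply, sum_single_apply, if_neg hk',
      sum_single_apply _ fun _ => ((√(2 * c n) : ℝ) : ℂ), if_pos hk, zero_add,
      Complex.norm_real, Real.norm_eq_abs, sq_abs, Real.sq_sqrt (by positivity)]
    linarith

end Residual

section Sequence

variable {α : ℝ} {σ : ℕ → ℝ} {σ0 L : ℝ}

theorem exists_abs_sub_le_mul_rpow
    (hrate : Tendsto (fun k : ℕ => ((k + 1 : ℕ) : ℝ) ^ α * (σ k - σ0)) atTop (𝓝 L)) :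
    ∃ C > 0, ∀ k : ℕ, |σ k - σ0| ≤ C * ((k + 1 : ℕ) : ℝ) ^ (-α) := by
  obtain ⟨C, hC⟩ := hrate.abs.bddAbove_range
  refine ⟨max C 1, by positivity, fun k => ?_⟩
  have h1 : |((k + 1 : ℕ) : ℝ) ^ α * (σ k - σ0)| ≤ C := hC ⟨k, rfl⟩
  have hp : 0 < ((k + 1 : ℕ) : ℝ) ^ α := by positivity
  rw [abs_mul, abs_of_pos hp] at h1
  rw [Real.rpow_neg (by positivity), ← div_eq_mul_inv, le_div_iff₀ hp, mul_comm]
  exact h1.trans (le_max_left _ _)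

theorem gap_le_abs_sub (hmono : StrictMono σ ∨ StrictAnti σ) {j k : ℕ} (hjk : j < k) :
    |σ (j + 1) - σ j| ≤ |σ k - σ j| := by
  rcases hmono with h | h
  · have h1 := h.monotone (Nat.succ_le_of_lt hjk)
    have h2 := h (Nat.lt_succ_self j)
    simp only [Nat.succ_eq_add_one] at h1 h2
    rw [abs_of_pos (by linarith), abs_of_nonneg (by linarith)]
    linarith
  · have h1 := h.antitone (Nat.succ_le_of_lt hjk)
    have h2 := h (Nat.lt_succ_self j)
    simp only [Nat.succ_eq_add_one] at h1 h2
    rw [abs_of_neg (by linarith), abs_of_nonpos (by linarith)]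
    linarith

theorem gap_le_abs_sub_of_ne (hmono : StrictMono σ ∨ StrictAnti σ)
    (hgap : Antitone fun k : ℕ => |σ (k + 1) - σ k|) {j k n : ℕ} (hk : k ≤ n) (hjk : j ≠ k) :
    |σ (n + 1) - σ n| ≤ |σ j - σ k| := by
  rcases lt_or_gt_of_ne hjk with h | h
  · rw [abs_sub_comm (σ j)]
    exact (hgap (h.le.trans hk)).trans (gap_le_abs_sub hmono h)
  · exact (hgap hk).trans (gap_le_abs_sub hmono h)

theorem abs_sub_le_mul_gap (hgap : Antitone fun k : ℕ => |σ (k + 1) - σ k|) (n m : ℕ) :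
    |σ (n + m) - σ n| ≤ m * |σ (n + 1) - σ n| := by
  induction m with
  | zero => simp
  | succ m ih =>
    have h1 : |σ (n + m + 1) - σ (n + m)| ≤ |σ (n + 1) - σ n| := hgap (Nat.le_add_right n m)
    have h2 := abs_sub_le (σ (n + m + 1)) (σ (n + m)) (σ n)
    rw [← add_assoc]
    push_cast
    linarith

theorem exists_rpow_le_gap (hα : 0 < α) (hL : L ≠ 0)
    (hrate : Tendsto (fun k : ℕ => ((k + 1 : ℕ) : ℝ) ^ α * (σ k - σ0)) atTop (𝓝 L))
    (hgap : Antitone fun k : ℕ => |σ (k + 1) - σ k|) :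
    ∃ c > 0, ∀ᶠ n : ℕ in atTop, c * ((n + 1 : ℕ) : ℝ) ^ (-(1 + α)) ≤ |σ (n + 1) - σ n| := by
  have h2 : (2 : ℝ) ^ (-α) < 1 := Real.rpow_lt_one_of_one_lt_of_neg one_lt_two (by linarith)
  have hl : 0 < |L| * (1 - 2 ^ (-α)) := mul_pos (abs_pos.2 hL) (by linarith)
  refine ⟨|L| * (1 - 2 ^ (-α)) / 2, by positivity, ?_⟩
  have hsub : Tendsto (fun n : ℕ => 2 * n + 1) atTop atTop :=
    tendsto_atTop_mono (fun n => (by omega : n ≤ 2 * n + 1)) tendsto_id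
  have hlim := hrate.abs.sub ((hrate.abs.comp hsub).const_mul ((2 : ℝ) ^ (-α)))
  have hlt : |L| * (1 - 2 ^ (-α)) / 2 < |L| - 2 ^ (-α) * |L| := by linarith
  filter_upwards [hlim.eventually (lt_mem_nhds hlt)] with n hn
  have hp : 0 < ((n + 1 : ℕ) : ℝ) := by positivity
  have hpa : 0 < ((n + 1 : ℕ) : ℝ) ^ α := by positivity
  have hcast : ((2 * n + 1 + 1 : ℕ) : ℝ) = 2 * ((n + 1 : ℕ) : ℝ) := by push_cast; ring
  have h22 : (2 : ℝ) ^ (-α) * 2 ^ α = 1 := by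
    rw [← Real.rpow_add two_pos]; simp
  simp only [Function.comp_apply, abs_mul, hcast, Real.mul_rpow zero_le_two hp.le,
    abs_of_pos hpa, abs_of_pos (Real.rpow_pos_of_pos two_pos α)] at hn
  have hn' : |L| * (1 - 2 ^ (-α)) / 2 <
      ((n + 1 : ℕ) : ℝ) ^ α * (|σ n - σ0| - |σ (2 * n + 1) - σ0|) := by
    refine hn.trans_eq ?_
    linear_combination (-((n + 1 : ℕ) : ℝ) ^ α * |σ (2 * n + 1) - σ0|) * h22
  have h3 := abs_sub_le_mul_gap hgap n (n + 1)
  rw [show n + (n + 1) = 2 * n + 1 by ring] at h3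
  have h4 : |σ n - σ0| - |σ (2 * n + 1) - σ0| ≤ |σ (2 * n + 1) - σ n| := by
    have := abs_sub_le (σ n) (σ (2 * n + 1)) σ0
    rw [abs_sub_comm (σ n) (σ (2 * n + 1))] at this
    linarith
  have h5 : |L| * (1 - 2 ^ (-α)) / 2 ≤
      ((n + 1 : ℕ) : ℝ) ^ (1 + α) * |σ (n + 1) - σ n| := by
    rw [add_comm 1 α, Real.rpow_add hp, Real.rpow_one, mul_assoc]
    exact hn'.le.trans (mul_le_mul_of_nonneg_left (h4.trans h3) hpa.le)
  rw [Real.rpow_neg hp.le, ← div_eq_mul_inv, div_le_iff₀ (by positivity)]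
  linarith

end Sequence

section Limits

theorem tendsto_neg_log_nhdsGT_zero : Tendsto (fun ε : ℝ => -Real.log ε) (𝓝[>] 0) atTop :=
  tendsto_neg_atBot_atTop.comp Real.tendsto_log_nhdsGT_zero

theorem eventually_div_le_add {J : ℝ → ℝ} {q a B δ : ℝ} (hq : q < 1) (hδ : 0 < δ)
    (h : ∀ᶠ ε in 𝓝[>] (0 : ℝ), Real.log (J ε) ≤ (1 - q) * (a * -Real.log ε + B)) :
    ∀ᶠ ε in 𝓝[>] (0 : ℝ), Real.log (J ε) / ((q - 1) * Real.log ε) ≤ a + δ := by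
  filter_upwards [h, tendsto_neg_log_nhdsGT_zero.eventually_ge_atTop (B / δ),
    tendsto_neg_log_nhdsGT_zero.eventually_gt_atTop 0] with ε h1 h2 h3
  have hq' : 0 < 1 - q := by linarith
  rw [show (q - 1) * Real.log ε = (1 - q) * -Real.log ε by ring, div_le_iff₀ (by positivity)]
  rw [div_le_iff₀ hδ] at h2
  refine h1.trans ?_
  rw [mul_left_comm]
  gcongr
  linarith

theorem eventually_neg_le_div {J : ℝ → ℝ} {q B δ : ℝ} (hq : q < 1) (hδ : 0 < δ)
    (h : ∀ᶠ ε in 𝓝[>] (0 : ℝ), B ≤ Real.log (J ε)) :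
    ∀ᶠ ε in 𝓝[>] (0 : ℝ), -δ ≤ Real.log (J ε) / ((q - 1) * Real.log ε) := by
  have hq' : 0 < 1 - q := by linarith
  filter_upwards [h, tendsto_neg_log_nhdsGT_zero.eventually_ge_atTop (-B / ((1 - q) * δ)),
    tendsto_neg_log_nhdsGT_zero.eventually_gt_atTop 0] with ε h1 h2 h3
  rw [show (q - 1) * Real.log ε = (1 - q) * -Real.log ε by ring, le_div_iff₀ (by positivity)]
  rw [div_le_iff₀ (by positivity)] at h2
  linarith

theorem liminf_eq_of_forall_eventually_of_forall_frequently {ι : Type*} {l : Filter ι}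
    [l.NeBot] {f : ι → ℝ} {a : ℝ} (hle : ∀ δ > 0, ∀ᶠ i in l, a - δ ≤ f i)
    (hge : ∀ δ > 0, ∃ᶠ i in l, f i ≤ a + δ) : liminf f l = a := by
  have hb : IsBoundedUnder (· ≥ ·) l f := ⟨a - 1, hle 1 one_pos⟩
  have hc : IsCoboundedUnder (· ≥ ·) l f := IsCoboundedUnder.of_frequently_le (hge 1 one_pos)
  refine le_antisymm (le_of_forall_pos_le_add fun δ hδ => ?_)
    (le_of_forall_pos_le_add fun δ hδ => ?_)
  · exact liminf_le_of_frequently_le (hge δ hδ) hb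
  · linarith [le_liminf_of_le hc (hle δ hδ)]

theorem limsup_eq_of_forall_eventually_of_forall_frequently {ι : Type*} {l : Filter ι}
    [l.NeBot] {f : ι → ℝ} {a : ℝ} (hle : ∀ δ > 0, ∀ᶠ i in l, f i ≤ a + δ)
    (hge : ∀ δ > 0, ∃ᶠ i in l, a - δ ≤ f i) : limsup f l = a := by
  have hb : IsBoundedUnder (· ≤ ·) l f := ⟨a + 1, hle 1 one_pos⟩
  have hc : IsCoboundedUnder (· ≤ ·) l f := IsCoboundedUnder.of_frequently_ge (hge 1 one_pos)
  refine le_antisymm (le_of_forall_pos_le_add fun δ hδ => ?_)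
    (le_of_forall_pos_le_add fun δ hδ => ?_)
  · exact limsup_le_of_le hc (hle δ hδ)
  · linarith [le_limsup_of_frequently_le (hge δ hδ) hb]

end Limits

section Dimensions

theorem measure_Ioo_eq_singleton {μ : Measure ℝ} {σ : ℕ → ℝ} {ε : ℝ} {k : ℕ}
    (hμ : μ (range σ)ᶜ = 0) (hε : 0 < ε)
    (hsep : ∀ j, j ≠ k → ε ≤ |σ j - σ k|) : μ (Ioo (σ k - ε) (σ k + ε)) = μ {σ k} := by
  refine le_antisymm ?_ (measure_mono (by simpa using hε))
  have h : Ioo (σ k - ε) (σ k + ε) ⊆ {σ k} ∪ (range σ)ᶜ := by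
    intro x hx
    by_cases hr : x ∈ range σ
    · obtain ⟨j, rfl⟩ := hr
      left
      by_contra hj
      have h1 := hsep j fun h => hj (by rw [h]; rfl)
      have h2 : |σ j - σ k| < ε := abs_lt.2 ⟨by linarith [hx.1], by linarith [hx.2]⟩
      exact absurd h1 (not_le.2 h2)
    · exact Or.inr hr
  calc μ (Ioo (σ k - ε) (σ k + ε)) ≤ μ {σ k} + μ (range σ)ᶜ :=
        (measure_mono h).trans (measure_union_le _ _)
    _ = μ {σ k} := by rw [hμ, add_zero]

variable {μ : Measure ℝ} [IsFiniteMeasure μ] {σ : ℕ → ℝ} {q σ0 C : ℝ}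

theorem toReal_fracIntegral_le_rpow_mul {ε ρ : ℝ} {n : ℕ} (hμ : μ (range σ)ᶜ = 0)
    (hσ : Function.Injective σ) (hq0 : 0 < q) (hq : q < 1) (hε : 0 < ε)
    (hρ : ∀ k ≥ n, |σ k - σ0| ≤ ρ) :
    (fracIntegral μ q ε).toReal ≤ (n + (2 * ρ / ε + 2)) ^ (1 - q) * μ.real univ ^ q := by
  have hρ0 : 0 ≤ ρ := (abs_nonneg _).trans (hρ n le_rfl)
  have h := ENNReal.toReal_mono
    (ENNReal.mul_ne_top (ENNReal.rpow_ne_top_of_nonneg (by linarith) ENNReal.ofReal_ne_top)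
      (ENNReal.rpow_ne_top_of_nonneg hq0.le (measure_ne_top _ _)))
    (fracIntegral_le_rpow_mul hμ hσ hq0 hq hε hρ)
  rwa [ENNReal.toReal_mul, ← ENNReal.toReal_rpow, ← ENNReal.toReal_rpow,
    ENNReal.toReal_ofReal (by positivity)] at h

theorem fracIntegral_ne_top {ε : ℝ} (hμ : μ (range σ)ᶜ = 0)
    (hσ : Function.Injective σ) (hq0 : 0 < q) (hq : q < 1) (hε : 0 < ε)
    (hC : ∀ k, |σ k - σ0| ≤ C) : fracIntegral μ q ε ≠ ⊤ :=
  ne_top_of_le_ne_top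
    (ENNReal.mul_ne_top (ENNReal.rpow_ne_top_of_nonneg (by linarith) ENNReal.ofReal_ne_top)
      (ENNReal.rpow_ne_top_of_nonneg hq0.le (measure_ne_top _ _)))
    (fracIntegral_le_rpow_mul (n := 0) hμ hσ hq0 hq hε fun k _ => hC k)

theorem toReal_fracIntegral_le_add_mul {ε δ : ℝ} {n : ℕ} (hμ : μ (range σ)ᶜ = 0)
    (hq0 : 0 < q) (hq : q < 1) (hε : 0 < ε) (hC : ∀ k, |σ k - σ0| ≤ C) (hδ : 0 ≤ δ)
    (htail : μ (σ '' Ici n) ≤ ENNReal.ofReal δ) :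
    (fracIntegral μ q ε).toReal ≤ n * μ.real univ ^ q + (2 * C / ε + 2) * δ ^ q := by
  have hC0 : 0 ≤ C := (abs_nonneg _).trans (hC 0)
  have h := (fracIntegral_le_add_mul hμ hq0 hq hε (n := n) fun k _ => hC k).trans
    (add_le_add_right (mul_le_mul_right (ENNReal.rpow_le_rpow htail hq0.le) _) _)
  have h1 : (n : ℝ≥0∞) * μ univ ^ q ≠ ⊤ :=
    ENNReal.mul_ne_top (ENNReal.natCast_ne_top n)
      (ENNReal.rpow_ne_top_of_nonneg hq0.le (measure_ne_top _ _))
  have h2 : ENNReal.ofReal (2 * C / ε + 2) * ENNReal.ofReal δ ^ q ≠ ⊤ :=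
    ENNReal.mul_ne_top ENNReal.ofReal_ne_top
      (ENNReal.rpow_ne_top_of_nonneg hq0.le ENNReal.ofReal_ne_top)
  have h3 := ENNReal.toReal_mono (ENNReal.add_ne_top.2 ⟨h1, h2⟩) h
  rwa [ENNReal.toReal_add h1 h2, ENNReal.toReal_mul, ENNReal.toReal_mul, ← ENNReal.toReal_rpow,
    ← ENNReal.toReal_rpow, ENNReal.toReal_ofReal (by positivity), ENNReal.toReal_ofReal hδ,
    ENNReal.toReal_natCast] at h3

theorem exists_pos_le_toReal_fracIntegral (hμ : μ (range σ)ᶜ = 0)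
    (hσ : Function.Injective σ) (hq0 : 0 < q) (hq : q < 1) (hC : ∀ k, |σ k - σ0| ≤ C)
    {k : ℕ} (hk : μ {σ k} ≠ 0) :
    ∃ b > 0, ∀ ε > 0, b ≤ (fracIntegral μ q ε).toReal := by
  have hM : μ univ ≠ 0 := fun h => hk (measure_mono_null (subset_univ _) h)
  have hM' : μ univ ^ (q - 1) ≠ 0 := by
    simp [ENNReal.rpow_eq_zero_iff, hM]
  have hM'' : μ univ ^ (q - 1) ≠ ⊤ := by
    simp [ENNReal.rpow_eq_top_iff, hM]
  refine ⟨(μ univ ^ (q - 1) * μ {σ k}).toReal,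
    ENNReal.toReal_pos (mul_ne_zero hM' hk) (ENNReal.mul_ne_top hM'' (measure_ne_top _ _)),
    fun ε hε => ENNReal.toReal_mono (fracIntegral_ne_top hμ hσ hq0 hq hε hC) ?_⟩
  refine le_trans ?_ (sum_le_fracIntegral hσ hε {k} (by simpa using hk))
  rw [Finset.sum_singleton]
  gcongr ?_ * _
  rw [← neg_sub 1 q, ENNReal.rpow_neg, ENNReal.rpow_neg]
  exact ENNReal.inv_le_inv.2 (ENNReal.rpow_le_rpow (measure_mono (subset_univ _)) (by linarith))

theorem card_mul_rpow_le_toReal_fracIntegral {ε b : ℝ} (hμ : μ (range σ)ᶜ = 0)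
    (hσ : Function.Injective σ) (hq0 : 0 < q) (hq : q < 1) (hε : 0 < ε)
    (hC : ∀ k, |σ k - σ0| ≤ C) (s : Finset ℕ) (hb : 0 < b)
    (hs : ∀ k ∈ s, ENNReal.ofReal b ≤ μ {σ k})
    (hsep : ∀ k ∈ s, ∀ j, j ≠ k → ε ≤ |σ j - σ k|) :
    s.card * b ^ q ≤ (fracIntegral μ q ε).toReal := by
  have h0 : ∀ k ∈ s, μ {σ k} ≠ 0 := fun k hk =>
    ((ENNReal.ofReal_pos.2 hb).trans_le (hs k hk)).ne'
  have h : s.card * ENNReal.ofReal b ^ q ≤ fracIntegral μ q ε := by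
    refine le_trans ?_ (sum_le_fracIntegral hσ hε s h0)
    rw [← nsmul_eq_mul]
    refine Finset.card_nsmul_le_sum _ _ _ fun k hk => ?_
    rw [measure_Ioo_eq_singleton hμ hε (hsep k hk)]
    nth_rewrite 2 [← ENNReal.rpow_one (μ {σ k})]
    rw [← ENNReal.rpow_add _ _ (h0 k hk) (measure_ne_top _ _), sub_add_cancel]
    exact ENNReal.rpow_le_rpow (hs k hk) hq0.le
  have h1 := ENNReal.toReal_mono (fracIntegral_ne_top hμ hσ hq0 hq hε hC) h
  rwa [ENNReal.toReal_mul, ← ENNReal.toReal_rpow, ENNReal.toReal_ofReal hb.le,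
    ENNReal.toReal_natCast] at h1

theorem eventually_div_le_one_div_add {α δ : ℝ} (hα : 0 < α) (hμ : μ (range σ)ᶜ = 0)
    (hσ : Function.Injective σ) (hq0 : 0 < q) (hq : q < 1) (hC0 : 0 < C)
    (hC : ∀ k : ℕ, |σ k - σ0| ≤ C * ((k + 1 : ℕ) : ℝ) ^ (-α)) {b : ℝ} (hb : 0 < b)
    (hbI : ∀ ε > 0, b ≤ (fracIntegral μ q ε).toReal) (hM : 0 < μ.real univ) (hδ : 0 < δ) :
    ∀ᶠ ε in 𝓝[>] (0 : ℝ), Real.log (fracIntegral μ q ε).toReal / ((q - 1) * Real.log ε) ≤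
      1 / (1 + α) + δ := by
  have hq' : 0 < 1 - q := by linarith
  refine eventually_div_le_add (B := Real.log (4 + 2 * C) + q * Real.log (μ.real univ) / (1 - q))
    hq hδ ?_
  filter_upwards [Ioo_mem_nhdsGT (zero_lt_one' ℝ)] with ε hε
  obtain ⟨hε0, hε1⟩ := hε
  set s := ε ^ (-(1 / (1 + α))) with hs
  have hs0 : 0 < s := Real.rpow_pos_of_pos hε0 _
  have hs1 : 1 ≤ s := Real.one_le_rpow_of_pos_of_le_one_of_nonpos hε0 hε1.le
    (neg_nonpos.2 (by positivity))
  have hsα : s ^ (-α) / ε = s := by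
    have h1 : ε = s ^ (-(1 + α)) := by
      rw [hs, ← Real.rpow_mul hε0.le, neg_mul_neg, one_div_mul_cancel (by positivity),
        Real.rpow_one]
    nth_rewrite 1 [h1]
    rw [← Real.rpow_sub hs0, show -α - -(1 + α) = 1 by ring, Real.rpow_one]
  have hρ : ∀ k ≥ ⌈s⌉₊, |σ k - σ0| ≤ C * s ^ (-α) := by
    intro k hk
    refine (hC k).trans (mul_le_mul_of_nonneg_left ?_ hC0.le)
    refine Real.rpow_le_rpow_of_nonpos hs0 ?_ (by linarith)
    have := Nat.ceil_le.1 hk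
    push_cast
    linarith
  have h := toReal_fracIntegral_le_rpow_mul hμ hσ hq0 hq hε0 hρ
  have hn := (Nat.ceil_lt_add_one hs0.le).le
  have hN : (⌈s⌉₊ : ℝ) + (2 * (C * s ^ (-α)) / ε + 2) ≤ (4 + 2 * C) * s := by
    rw [show 2 * (C * s ^ (-α)) / ε = 2 * C * (s ^ (-α) / ε) by ring, hsα]
    linarith
  have h' : (fracIntegral μ q ε).toReal ≤ ((4 + 2 * C) * s) ^ (1 - q) * μ.real univ ^ q :=
    h.trans (by gcongr)
  have h2 := Real.log_le_log (hb.trans_le (hbI ε hε0)) h'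
  rw [Real.log_mul (by positivity) (by positivity), Real.log_rpow (by positivity),
    Real.log_rpow hM, Real.log_mul (by positivity) hs0.ne', hs, Real.log_rpow hε0] at h2
  refine h2.trans_eq ?_
  field_simp
  ring

theorem frequently_div_le {δ : ℝ} (hμ : μ (range σ)ᶜ = 0) (hq0 : 0 < q) (hq : q < 1)
    (hC : ∀ k, |σ k - σ0| ≤ C) {b : ℝ} (hb : 0 < b)
    (hbI : ∀ ε > 0, b ≤ (fracIntegral μ q ε).toReal)
    (htail : ∃ᶠ n : ℕ in atTop, μ (σ '' Ici n) ≤ ENNReal.ofReal (Real.exp (-(n : ℝ) ^ 2)))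
    (hδ : 0 < δ) :
    ∃ᶠ ε in 𝓝[>] (0 : ℝ),
      Real.log (fracIntegral μ q ε).toReal / ((q - 1) * Real.log ε) ≤ δ := by
  have hq' : 0 < 1 - q := by linarith
  have hC0 : 0 ≤ C := (abs_nonneg _).trans (hC 0)
  have hε : Tendsto (fun n : ℕ => Real.exp (-(n : ℝ))) atTop (𝓝[>] 0) :=
    tendsto_nhdsWithin_iff.2 ⟨Real.tendsto_exp_neg_atTop_nhds_zero.comp
      tendsto_natCast_atTop_atTop, Eventually.of_forall fun n => Real.exp_pos _⟩
  refine hε.frequently ?_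
  set K := μ.real univ ^ q + (2 * C + 2) * Real.exp (1 / q) with hK
  have hK0 : 0 < K := by positivity
  have hlim : Tendsto (fun n : ℕ => (Real.log K + Real.log 2) / n + Real.log n / n) atTop
      (𝓝 0) := by
    have h1 := (tendsto_const_div_atTop_nhds_zero_nat (Real.log K + Real.log 2))
    have h2 := (Real.isLittleO_log_id_atTop.tendsto_div_nhds_zero).comp
      (tendsto_natCast_atTop_atTop (R := ℝ))
    simpa using h1.add h2
  refine (htail.and_eventually ((hlim.eventually (gt_mem_nhds (mul_pos hq' hδ))).and
    (eventually_ge_atTop 1))).mono ?_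
  rintro n ⟨hn, hlog, hn1⟩
  have hn1' : (1 : ℝ) ≤ n := by exact_mod_cast hn1
  have hn0 : (0 : ℝ) < n := by linarith
  have h := toReal_fracIntegral_le_add_mul hμ hq0 hq (Real.exp_pos (-(n : ℝ))) hC
    (Real.exp_pos _).le hn
  have h1 : (2 * C / Real.exp (-(n : ℝ)) + 2) * Real.exp (-(n : ℝ) ^ 2) ^ q ≤
      (2 * C + 2) * Real.exp (1 / q) := by
    have h2 : 2 * C / Real.exp (-(n : ℝ)) + 2 ≤ (2 * C + 2) * Real.exp n := by
      rw [Real.exp_neg, div_inv_eq_mul]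
      have := Real.one_le_exp hn0.le
      linarith
    have h3 : Real.exp n * Real.exp (-(n : ℝ) ^ 2) ^ q ≤ Real.exp (1 / q) := by
      rw [← Real.exp_mul, ← Real.exp_add, Real.exp_le_exp, le_div_iff₀ hq0]
      nlinarith [sq_nonneg (q * (n : ℝ) - 1 / 2)]
    calc _ ≤ (2 * C + 2) * Real.exp n * Real.exp (-(n : ℝ) ^ 2) ^ q := by gcongr
      _ ≤ _ := by rw [mul_assoc]; gcongr
  have h2 : (fracIntegral μ q (Real.exp (-(n : ℝ)))).toReal ≤ K * (2 * n) := by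
    have : (0 : ℝ) ≤ μ.real univ ^ q := by positivity
    have h4 : 0 ≤ (2 * C + 2) * Real.exp (1 / q) := by positivity
    rw [hK]
    nlinarith [mul_nonneg this hn0.le, mul_le_mul_of_nonneg_left hn1' h4]
  have h3 := Real.log_le_log (hb.trans_le (hbI _ (Real.exp_pos _))) h2
  rw [Real.log_mul hK0.ne' (by positivity), Real.log_mul two_ne_zero hn0.ne'] at h3
  rw [Real.log_exp, show (q - 1) * -(n : ℝ) = (1 - q) * n by ring, div_le_iff₀ (by positivity)]
  rw [← add_div, div_lt_iff₀ hn0] at hlog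
  linarith

theorem tendsto_log_block_ratio {α c : ℝ} (hα : 0 < α) (hq : q < 1) :
    Tendsto (fun x : ℝ => ((1 - q) * x - q * Real.log x) /
      ((1 - q) * ((1 + α) * x + c))) atTop (𝓝 (1 / (1 + α))) := by
  have hq' : 0 < 1 - q := by linarith
  have h1 := (Real.isLittleO_log_id_atTop.tendsto_div_nhds_zero).const_mul q
  have h2 : Tendsto (fun x : ℝ => c / x) atTop (𝓝 0) := tendsto_const_nhds.div_atTop tendsto_id
  have h3 := (h1.const_sub (1 - q)).div ((h2.const_add (1 + α)).const_mul (1 - q))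
    (by simp; constructor <;> linarith)
  have h4 : (1 - q - q * 0) / ((1 - q) * (1 + α + 0)) = 1 / (1 + α) := by field_simp; ring
  rw [h4] at h3
  refine h3.congr' ?_
  filter_upwards [eventually_gt_atTop 0] with x hx
  simp only [id, Pi.div_apply]
  rw [← mul_div_mul_right _ _ hx.ne']
  congr 1 <;> field_simp

theorem frequently_sub_le_div {α L δ : ℝ} (hα : 0 < α) (hL : L ≠ 0)
    (hmono : StrictMono σ ∨ StrictAnti σ) (hconv : Tendsto σ atTop (𝓝 σ0))
    (hrate : Tendsto (fun k : ℕ => ((k + 1 : ℕ) : ℝ) ^ α * (σ k - σ0)) atTop (𝓝 L))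
    (hgap : Antitone fun k : ℕ => |σ (k + 1) - σ k|) (hμ : μ (range σ)ᶜ = 0)
    (hσ : Function.Injective σ) (hq0 : 0 < q) (hq : q < 1) (hC : ∀ k, |σ k - σ0| ≤ C)
    (hblock : ∃ᶠ n : ℕ in atTop, ∀ k ∈ Finset.Ico n (2 * n),
      ENNReal.ofReal (1 / (n * Real.log n)) ≤ μ {σ k}) (hδ : 0 < δ) :
    ∃ᶠ ε in 𝓝[>] (0 : ℝ), 1 / (1 + α) - δ ≤
      Real.log (fracIntegral μ q ε).toReal / ((q - 1) * Real.log ε) := by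
  have hq' : 0 < 1 - q := by linarith
  obtain ⟨c, hc, hcgap⟩ := exists_rpow_le_gap hα hL hrate hgap
  have hdouble : Tendsto (fun n : ℕ => 2 * n) atTop atTop :=
    tendsto_atTop_mono (fun n => (by omega : n ≤ 2 * n)) tendsto_id
  have hgap0 : ∀ n, 0 < |σ (n + 1) - σ n| := fun n =>
    abs_pos.2 (sub_ne_zero.2 (hσ.ne (by omega)))
  have hgap_lim : Tendsto (fun n => |σ (n + 1) - σ n|) atTop (𝓝[>] 0) :=
    tendsto_nhdsWithin_iff.2 ⟨by
      simpa using ((hconv.comp (tendsto_add_atTop_nat 1)).sub hconv).abs,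
      Eventually.of_forall hgap0⟩
  have hε := hgap_lim.comp hdouble
  have hlog : Tendsto (fun n : ℕ => Real.log n) atTop atTop :=
    Real.tendsto_log_atTop.comp tendsto_natCast_atTop_atTop
  set B := (1 + α) * Real.log 3 - Real.log c with hB
  have hratio := (tendsto_log_block_ratio (c := B) hα hq).comp hlog
  refine hε.frequently ((hblock.and_eventually
    ((hratio.eventually (lt_mem_nhds (sub_lt_self _ hδ))).and
    ((hratio.eventually (lt_mem_nhds (by positivity : 0 < 1 / (1 + α)))).and
    ((hdouble.eventually hcgap).and ((eventually_ge_atTop 2).and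
    ((hε.eventually (Ioo_mem_nhdsGT zero_lt_one)).and
    (tendsto_atTop_add_const_right _ B (hlog.const_mul_atTop
      (by positivity : 0 < 1 + α)) |>.eventually_gt_atTop 0))))))).mono ?_)
  rintro n ⟨hb, h1, h2, h3, h4, h5, h6⟩
  simp only [Function.comp_apply] at h1 h2 h5 ⊢
  have hn2 : (2 : ℝ) ≤ n := by exact_mod_cast h4
  have hn0 : (0 : ℝ) < n := by linarith
  have hln : 0 < Real.log n := Real.log_pos (by linarith)
  set ε := |σ (2 * n + 1) - σ (2 * n)| with hεdef
  have hsum := card_mul_rpow_le_toReal_fracIntegral hμ hσ hq0 hq h5.1 hC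
    (Finset.Ico n (2 * n)) (b := 1 / (n * Real.log n)) (by positivity) hb
    fun k hk j hj => gap_le_abs_sub_of_ne hmono hgap (Finset.mem_Ico.1 hk).2.le hj
  rw [Nat.card_Ico, show 2 * n - n = n by omega] at hsum
  have hlogI := Real.log_le_log (by positivity) hsum
  rw [Real.log_mul hn0.ne' (by positivity), Real.log_rpow (by positivity), one_div, Real.log_inv,
    Real.log_mul hn0.ne' hln.ne'] at hlogI
  have hlogε : -Real.log ε ≤ (1 + α) * Real.log n + B := by
    have h7 : Real.log (c * ((2 * n + 1 : ℕ) : ℝ) ^ (-(1 + α))) ≤ Real.log ε :=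
      Real.log_le_log (by positivity) h3
    rw [Real.log_mul hc.ne' (by positivity), Real.log_rpow (by positivity)] at h7
    have h8 : Real.log ((2 * n + 1 : ℕ) : ℝ) ≤ Real.log 3 + Real.log n := by
      rw [← Real.log_mul (by norm_num) hn0.ne']
      exact Real.log_le_log (by positivity) (by push_cast; linarith)
    have := mul_le_mul_of_nonneg_left h8 (by positivity : 0 ≤ 1 + α)
    rw [hB]
    linarith
  have hlε : 0 < -Real.log ε := neg_pos.2 (Real.log_neg h5.1 h5.2)
  have hnum : 0 < (1 - q) * Real.log n - q * Real.log (Real.log n) := by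
    rwa [div_pos_iff_of_pos_right (mul_pos hq' h6)] at h2
  refine h1.le.trans ?_
  rw [show (q - 1) * Real.log ε = (1 - q) * -Real.log ε by ring]
  have hlogI' : (1 - q) * Real.log n - q * Real.log (Real.log n) ≤
      Real.log (fracIntegral μ q ε).toReal := by linarith
  gcongr
  exact hnum.le.trans hlogI'

end Dimensions

/-- Here `σ k` stands for the eigenvalue `σ_{k+1}` (the sequence is indexed from 1 in the paper). -/
theorem generic_dimensions_of_power_distributed_eigenvalues
    (α : ℝ) (hα : 0 < α) (σ : ℕ → ℝ) (σ0 L : ℝ) (hL : L ≠ 0)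
    (hmono : StrictMono σ ∨ StrictAnti σ)
    (hconv : Tendsto σ atTop (𝓝 σ0))
    (hrate : Tendsto (fun k : ℕ => ((k + 1 : ℕ) : ℝ) ^ α * (σ k - σ0)) atTop (𝓝 L))
    (hgap : Antitone fun k : ℕ => |σ (k + 1) - σ k|) :
    ∃ R : Set (lp (fun _ : ℕ => ℂ) 2), R ∈ residual (lp (fun _ : ℕ => ℂ) 2) ∧
      ∀ ψ ∈ R, ∀ q ∈ Ioo (0 : ℝ) 1,
        Dlower (Measure.sum fun k : ℕ =>
          ENNReal.ofReal (‖ψ k‖ ^ 2) • Measure.dirac (σ k)) q = 0 ∧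
        Dupper (Measure.sum fun k : ℕ =>
          ENNReal.ofReal (‖ψ k‖ ^ 2) • Measure.dirac (σ k)) q = 1 / (1 + α) := by
  have hσ : Function.Injective σ := hmono.elim StrictMono.injective StrictAnti.injective
  obtain ⟨C, hC0, hC⟩ := exists_abs_sub_le_mul_rpow hrate
  have hC' : ∀ k, |σ k - σ0| ≤ C := fun k => (hC k).trans
    (mul_le_of_le_one_right hC0.le (Real.rpow_le_one_of_one_le_of_nonpos
      (by exact_mod_cast Nat.le_add_left 1 k) (by linarith)))
  have hlog : Tendsto (fun n : ℕ => Real.log n) atTop atTop :=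
    Real.tendsto_log_atTop.comp tendsto_natCast_atTop_atTop
  have hblock := frequently_large_block_mem_residual
    (c := fun n : ℕ => 1 / (n * Real.log n))
    (fun n => div_nonneg zero_le_one (mul_nonneg n.cast_nonneg (Real.log_natCast_nonneg n)))
    (by
      refine hlog.inv_tendsto_atTop.congr' ?_
      filter_upwards [eventually_gt_atTop 0] with n hn
      have : (n : ℝ) ≠ 0 := by exact_mod_cast hn.ne'
      simp only [Pi.inv_apply]
      field_simp)
    (by
      filter_upwards [hlog.eventually_gt_atTop 0, eventually_gt_atTop 0] with n hn hn0
      have : (0 : ℝ) < n := by exact_mod_cast hn0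
      positivity)
  have htail := frequently_small_tail_mem_residual (δ := fun n : ℕ => Real.exp (-(n : ℝ) ^ 2))
    fun n => Real.exp_pos _
  refine ⟨_, inter_mem hblock htail, ?_⟩
  rintro ψ ⟨hψb, hψt⟩ q ⟨hq0, hq1⟩
  change Dlower (spectralMeasure σ ψ) q = 0 ∧ Dupper (spectralMeasure σ ψ) q = 1 / (1 + α)
  have hμ := spectralMeasure_compl_range σ ψ
  have hb' : ∃ᶠ n : ℕ in atTop, ∀ k ∈ Finset.Ico n (2 * n),
      ENNReal.ofReal (1 / (n * Real.log n)) ≤ spectralMeasure σ ψ {σ k} :=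
    hψb.mono fun n hn k hk => by
      rw [spectralMeasure_singleton ψ hσ]
      exact ENNReal.ofReal_le_ofReal (hn k hk).le
  have ht' : ∃ᶠ n : ℕ in atTop,
      spectralMeasure σ ψ (σ '' Ici n) ≤ ENNReal.ofReal (Real.exp (-(n : ℝ) ^ 2)) :=
    hψt.mono fun n hn => spectralMeasure_image_Ici_le ψ hσ (le_of_lt hn)
  obtain ⟨k, hk⟩ : ∃ k, spectralMeasure σ ψ {σ k} ≠ 0 := by
    obtain ⟨n, hn, hn2⟩ := (hb'.and_eventually (eventually_ge_atTop 2)).exists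
    have hn2' : (2 : ℝ) ≤ n := by exact_mod_cast hn2
    have hln : 0 < Real.log n := Real.log_pos (by linarith)
    refine ⟨n, ((ENNReal.ofReal_pos.2 ?_).trans_le
      (hn n (Finset.mem_Ico.2 ⟨le_rfl, by omega⟩))).ne'⟩
    positivity
  obtain ⟨b, hb, hbI⟩ := exists_pos_le_toReal_fracIntegral hμ hσ hq0 hq1 hC' hk
  have hM : 0 < (spectralMeasure σ ψ).real univ :=
    ENNReal.toReal_pos (fun h => hk (measure_mono_null (subset_univ _) h)) (measure_ne_top _ _)
  constructor
  · refine liminf_eq_of_forall_eventually_of_forall_frequently (fun δ hδ => ?_) fun δ hδ => ?_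
    · rw [zero_sub]
      refine eventually_neg_le_div (B := Real.log b) hq1 hδ ?_
      filter_upwards [self_mem_nhdsWithin] with ε hε
      exact Real.log_le_log hb (hbI ε hε)
    · rw [zero_add]
      exact frequently_div_le hμ hq0 hq1 hC' hb hbI ht' hδ
  · exact limsup_eq_of_forall_eventually_of_forall_frequently
      (fun δ hδ => eventually_div_le_one_div_add hα hμ hσ hq0 hq1 hC0 hC hb hbI hM hδ)
      fun δ hδ => frequently_sub_le_div hα hL hmono hconv hrate hgap hμ hσ hq0 hq1 hC' hb' hδ
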